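/- arXiv:0711.2694 — 2 statements merged into one kernel-verified Lean document; each statement's English description precedes it below -/
import Mathlib

section
/- The weighted Sobolev space 𝓗¹(ℝ) forms a Banach algebra under pointwise multiplication, with a constant uniform in the potential: there exists C > 0 such that for every measurable function V : ℝ → ℝ with V(x) ≥ 0 for all x, and for all differentiable u, v : ℝ → ℂ with u, u', V^{1/2}u ∈ L²(ℝ) and v, v', V^{1/2}v ∈ L²(ℝ), the pointwise product uv satisfies uv, (uv)', V^{1/2}uv ∈ L²(ℝ) and ‖uv‖_{𝓗¹(ℝ)} ≤ C ‖u‖_{𝓗¹(ℝ)} ‖v‖_{𝓗¹(ℝ)}. -/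
open MeasureTheory

/-- The squared weighted Sobolev norm `‖φ‖²_{𝓗¹(ℝ)} = ∫ (|φ'|² + V |φ|² + |φ|²)`,
expressed in terms of a function `φ` and its derivative `φ'`. -/
noncomputable def H1Vnorm (V : ℝ → ℝ) (φ φ' : ℝ → ℂ) : ℝ :=
  Real.sqrt (∫ x : ℝ, (‖φ' x‖ ^ 2 + V x * ‖φ x‖ ^ 2 + ‖φ x‖ ^ 2))

/-- The squared supremum of an `H¹` function on the line is at most its squared `H¹` norm. -/
lemma sq_norm_le_integral_sq_norm_add {u u' : ℝ → ℂ} (hu : ∀ x : ℝ, HasDerivAt u (u' x) x)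
    (hu0 : Integrable (fun x => ‖u x‖ ^ 2)) (hu1 : Integrable (fun x => ‖u' x‖ ^ 2)) (x : ℝ) :
    ‖u x‖ ^ 2 ≤ ∫ y, (‖u' y‖ ^ 2 + ‖u y‖ ^ 2) := by
  have hderiv (y : ℝ) : HasDerivAt (fun y => ‖u y‖ ^ 2) (2 * inner ℝ (u y) (u' y)) y :=
    (hu y).norm_sq
  have hbound (y : ℝ) : ‖2 * inner ℝ (u y) (u' y)‖ ≤ ‖u' y‖ ^ 2 + ‖u y‖ ^ 2 := by
    have h := abs_real_inner_le_norm (u y) (u' y)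
    rw [Real.norm_eq_abs, abs_mul, abs_two]
    nlinarith [sq_nonneg (‖u y‖ - ‖u' y‖)]
  have hderiv_int : Integrable (fun y => 2 * inner ℝ (u y) (u' y)) := by
    refine (hu1.add hu0).mono' ?_ (.of_forall hbound)
    have h : (fun y => 2 * inner ℝ (u y) (u' y)) = deriv (fun y => ‖u y‖ ^ 2) :=
      funext fun y => (hderiv y).deriv.symm
    rw [h]
    exact (measurable_deriv _).aestronglyMeasurable
  have hlim := tendsto_zero_of_hasDerivAt_of_integrableOn_Iic (a := x)
    (fun y _ => hderiv y) hderiv_int.integrableOn hu0.integrableOn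
  have hftc := integral_Iic_of_hasDerivAt_of_tendsto' (a := x) (fun y _ => hderiv y)
    hderiv_int.integrableOn hlim
  rw [sub_zero] at hftc
  calc ‖u x‖ ^ 2 = ∫ y in Set.Iic x, 2 * inner ℝ (u y) (u' y) := hftc.symm
    _ ≤ ∫ y in Set.Iic x, (‖u' y‖ ^ 2 + ‖u y‖ ^ 2) :=
      setIntegral_mono hderiv_int.integrableOn (hu1.add hu0).integrableOn
        fun y => (le_abs_self _).trans (hbound y)
    _ ≤ ∫ y, (‖u' y‖ ^ 2 + ‖u y‖ ^ 2) :=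
      setIntegral_le_integral (hu1.add hu0) (.of_forall fun y => by positivity)

/-- The squared supremum of a function is at most its squared weighted Sobolev norm. -/
lemma sq_norm_le_integral_H1Vnorm {V : ℝ → ℝ} (hV : ∀ x, 0 ≤ V x) {u u' : ℝ → ℂ}
    (hu : ∀ x : ℝ, HasDerivAt u (u' x) x) (hu0 : Integrable (fun x => ‖u x‖ ^ 2))
    (hu1 : Integrable (fun x => ‖u' x‖ ^ 2)) (huV : Integrable (fun x => V x * ‖u x‖ ^ 2))
    (x : ℝ) :
    ‖u x‖ ^ 2 ≤ ∫ y, (‖u' y‖ ^ 2 + V y * ‖u y‖ ^ 2 + ‖u y‖ ^ 2) := by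
  refine (sq_norm_le_integral_sq_norm_add hu hu0 hu1 x).trans
    (integral_mono (hu1.add hu0) ((hu1.add huV).add hu0) fun y => ?_)
  have := mul_nonneg (hV y) (sq_nonneg ‖u y‖)
  beta_reduce
  linarith

/-- **The weighted space 𝓗¹(ℝ) is a Banach algebra under pointwise
multiplication, with a constant uniform in the potential.**
There is `C > 0` such that for every nonnegative measurable `V : ℝ → ℝ` and
all differentiable `u, v : ℝ → ℂ` with `u, u', V^{1/2} u ∈ L²` and
`v, v', V^{1/2} v ∈ L²`, the product `u v` satisfies
`u v, (u v)', V^{1/2} u v ∈ L²` and `‖u v‖_{𝓗¹} ≤ C ‖u‖_{𝓗¹} ‖v‖_{𝓗¹}`. -/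
theorem weighted_H1_banach_algebra :
    ∃ C : ℝ, 0 < C ∧
      ∀ (V : ℝ → ℝ), Measurable V → (∀ x, 0 ≤ V x) →
      ∀ (u u' v v' : ℝ → ℂ),
        (∀ x : ℝ, HasDerivAt u (u' x) x) →
        (∀ x : ℝ, HasDerivAt v (v' x) x) →
        Integrable (fun x => ‖u x‖ ^ 2) →
        Integrable (fun x => ‖u' x‖ ^ 2) →
        Integrable (fun x => V x * ‖u x‖ ^ 2) →
        Integrable (fun x => ‖v x‖ ^ 2) →
        Integrable (fun x => ‖v' x‖ ^ 2) →
        Integrable (fun x => V x * ‖v x‖ ^ 2) →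
        Integrable (fun x => ‖u x * v x‖ ^ 2) ∧
        Integrable (fun x => ‖u' x * v x + u x * v' x‖ ^ 2) ∧
        Integrable (fun x => V x * ‖u x * v x‖ ^ 2) ∧
        H1Vnorm V (fun x => u x * v x) (fun x => u' x * v x + u x * v' x) ≤
          C * H1Vnorm V u u' * H1Vnorm V v v' := by
  refine ⟨2, two_pos, fun V hVm hV u u' v v' hu hv hu0 hu1 huV hv0 hv1 hvV => ?_⟩
  have hAu := sq_norm_le_integral_H1Vnorm hV hu hu0 hu1 huV
  have hBv := sq_norm_le_integral_H1Vnorm hV hv hv0 hv1 hvV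
  have hIu : Integrable (fun y => ‖u' y‖ ^ 2 + V y * ‖u y‖ ^ 2 + ‖u y‖ ^ 2) :=
    (hu1.add huV).add hu0
  have hIv : Integrable (fun y => ‖v' y‖ ^ 2 + V y * ‖v y‖ ^ 2 + ‖v y‖ ^ 2) :=
    (hv1.add hvV).add hv0
  simp only [H1Vnorm]
  set A := ∫ y, (‖u' y‖ ^ 2 + V y * ‖u y‖ ^ 2 + ‖u y‖ ^ 2)
  set B := ∫ y, (‖v' y‖ ^ 2 + V y * ‖v y‖ ^ 2 + ‖v y‖ ^ 2)
  have hA0 : 0 ≤ A := (sq_nonneg _).trans (hAu 0)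
  have hB0 : 0 ≤ B := (sq_nonneg _).trans (hBv 0)
  have hum : Measurable u :=
    (continuous_iff_continuousAt.2 fun x => (hu x).continuousAt).measurable
  have hvm : Measurable v :=
    (continuous_iff_continuousAt.2 fun x => (hv x).continuousAt).measurable
  have hum' : Measurable u' := by
    rw [← funext fun x => (hu x).deriv]
    exact measurable_deriv u
  have hvm' : Measurable v' := by
    rw [← funext fun x => (hv x).deriv]
    exact measurable_deriv v
  have hsq (x : ℝ) : ‖u x * v x‖ ^ 2 ≤ A * ‖v x‖ ^ 2 := by
    rw [norm_mul, mul_pow]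
    exact mul_le_mul_of_nonneg_right (hAu x) (sq_nonneg _)
  have hVsq (x : ℝ) : V x * ‖u x * v x‖ ^ 2 ≤ A * (V x * ‖v x‖ ^ 2) :=
    (mul_le_mul_of_nonneg_left (hsq x) (hV x)).trans_eq (by ring)
  have hdsq (x : ℝ) :
      ‖u' x * v x + u x * v' x‖ ^ 2 ≤ 2 * B * ‖u' x‖ ^ 2 + 2 * A * ‖v' x‖ ^ 2 := by
    calc ‖u' x * v x + u x * v' x‖ ^ 2 ≤ (‖u' x * v x‖ + ‖u x * v' x‖) ^ 2 := by
          gcongr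
          exact norm_add_le _ _
      _ ≤ 2 * (‖v x‖ ^ 2 * ‖u' x‖ ^ 2) + 2 * (‖u x‖ ^ 2 * ‖v' x‖ ^ 2) := by
          simp only [norm_mul]
          linarith [sq_nonneg (‖u' x‖ * ‖v x‖ - ‖u x‖ * ‖v' x‖)]
      _ ≤ 2 * (B * ‖u' x‖ ^ 2) + 2 * (A * ‖v' x‖ ^ 2) := by
          gcongr
          exacts [hBv x, hAu x]
      _ = _ := by ring
  have hi0 : Integrable (fun x => ‖u x * v x‖ ^ 2) :=
    (hv0.const_mul A).mono' (by fun_prop) (.of_forall fun x => by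
      simpa only [Real.norm_of_nonneg (sq_nonneg ‖u x * v x‖)] using hsq x)
  have hi1 : Integrable (fun x => ‖u' x * v x + u x * v' x‖ ^ 2) :=
    ((hu1.const_mul (2 * B)).add (hv1.const_mul (2 * A))).mono' (by fun_prop)
      (.of_forall fun x => by
        simpa only [Pi.add_apply, Real.norm_of_nonneg (sq_nonneg ‖u' x * v x + u x * v' x‖)] using hdsq x)
  have hiV : Integrable (fun x => V x * ‖u x * v x‖ ^ 2) :=
    (hvV.const_mul A).mono' (by fun_prop) (.of_forall fun x => by
      simpa only [Real.norm_of_nonneg (mul_nonneg (hV x) (sq_nonneg ‖u x * v x‖))] using hVsq x)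
  refine ⟨hi0, hi1, hiV, ?_⟩
  have hle : ∫ x, (‖u' x * v x + u x * v' x‖ ^ 2 + V x * ‖u x * v x‖ ^ 2 + ‖u x * v x‖ ^ 2)
      ≤ 2 ^ 2 * A * B := by
    calc _ ≤ ∫ x, (2 * B * (‖u' x‖ ^ 2 + V x * ‖u x‖ ^ 2 + ‖u x‖ ^ 2)
            + 2 * A * (‖v' x‖ ^ 2 + V x * ‖v x‖ ^ 2 + ‖v x‖ ^ 2)) := by
          refine integral_mono ((hi1.add hiV).add hi0)
            ((hIu.const_mul (2 * B)).add (hIv.const_mul (2 * A))) fun x => ?_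
          have hVu := mul_nonneg hB0 (mul_nonneg (hV x) (sq_nonneg ‖u x‖))
          have hu2 := mul_nonneg hB0 (sq_nonneg ‖u x‖)
          have hVv := mul_nonneg hA0 (mul_nonneg (hV x) (sq_nonneg ‖v x‖))
          have hv2 := mul_nonneg hA0 (sq_nonneg ‖v x‖)
          beta_reduce
          linarith [hsq x, hVsq x, hdsq x]
      _ = 2 * B * A + 2 * A * B := by
          rw [integral_add (hIu.const_mul _) (hIv.const_mul _), integral_const_mul,
            integral_const_mul]
      _ = 2 ^ 2 * A * B := by ring
  refine (Real.sqrt_le_sqrt hle).trans_eq ?_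
  rw [Real.sqrt_mul (by positivity), Real.sqrt_mul (by positivity),
    Real.sqrt_sq zero_le_two]
end

section
/- Uniform summability of overlap coefficients of exponentially localized translates: let η > 0, C > 0, and let w₀ : ℝ → ℝ be a measurable function with |w₀(x)| ≤ C e^{−η|x|} for all x ∈ ℝ, and define wₙ(x) = w₀(x − 2πn) for n ∈ ℤ. Then there exists A > 0 (depending only on C and η) such that for all (n₁, n₂, n₃) ∈ ℤ³, the sum Σ_{n∈ℤ} |∫_ℝ wₙ(x) wₙ₁(x) wₙ₂(x) wₙ₃(x) dx| converges and is bounded by A ‖w₀‖²_{L⁴(ℝ)} ‖w₀‖_{L²(ℝ)}. -/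
open MeasureTheory

theorem integrable_exp_neg_mul_abs {η : ℝ} (hη : 0 < η) :
    Integrable (fun x : ℝ => Real.exp (-η * |x|)) := by
  rw [← integrableOn_univ, ← Set.Iic_union_Ioi (a := (0 : ℝ)), integrableOn_union]
  constructor
  · refine (integrableOn_exp_mul_Iic hη 0).congr_fun (fun x hx => ?_) measurableSet_Iic
    simp [abs_of_nonpos (Set.mem_Iic.1 hx)]
  · refine (integrableOn_exp_mul_Ioi (neg_lt_zero.2 hη) 0).congr_fun (fun x hx => ?_)
      measurableSet_Ioi
    simp [abs_of_pos (Set.mem_Ioi.1 hx)]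

theorem summable_int_exp_neg_mul_abs {c : ℝ} (hc : 0 < c) :
    Summable (fun n : ℤ => Real.exp (-c * |(n : ℝ)|)) := by
  have h : Summable (fun n : ℕ => Real.exp (-c * n)) := by
    simpa [mul_comm] using Real.summable_exp_nat_mul_iff.2 (neg_lt_zero.2 hc)
  exact Summable.of_nat_of_neg (by simpa using h) (by simpa using h)

/-- Exponentials centred at the points of the lattice `p ℤ` have uniformly bounded partial sums. -/
theorem sum_exp_neg_mul_abs_sub_le {η p : ℝ} (hη : 0 < η) (hp : 0 < p) (s : Finset ℤ) (x : ℝ) :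
    ∑ n ∈ s, Real.exp (-η * |x - p * n|) ≤
      Real.exp (η * p) * ∑' n : ℤ, Real.exp (-(η * p) * |(n : ℝ)|) := by
  have hsum := summable_int_exp_neg_mul_abs (mul_pos hη hp)
  set m : ℤ := ⌊x / p⌋
  have hterm (n : ℤ) : Real.exp (-η * |x - p * n|) ≤
      Real.exp (η * p) * Real.exp (-(η * p) * |((n - m : ℤ) : ℝ)|) := by
    rw [← Real.exp_add, Real.exp_le_exp]
    have h₁ : p * m ≤ x := by
      rw [mul_comm, ← le_div_iff₀ hp]; exact Int.floor_le _
    have h₂ : x ≤ p * m + p := by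
      have := (div_lt_iff₀ hp).1 (Int.lt_floor_add_one (x / p))
      linarith
    have h₃ : p * |((n - m : ℤ) : ℝ)| ≤ |x - p * n| + p := by
      rw [← abs_of_pos hp, ← abs_mul, abs_of_pos hp]
      push_cast
      rw [abs_le]
      constructor <;> linarith [neg_abs_le (x - p * n), le_abs_self (x - p * n)]
    nlinarith [mul_le_mul_of_nonneg_left h₃ hη.le]
  calc ∑ n ∈ s, Real.exp (-η * |x - p * n|)
      ≤ ∑ n ∈ s, Real.exp (η * p) * Real.exp (-(η * p) * |((n - m : ℤ) : ℝ)|) :=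
        Finset.sum_le_sum fun n _ => hterm n
    _ = Real.exp (η * p) * ∑ n ∈ s, Real.exp (-(η * p) * |((n - m : ℤ) : ℝ)|) :=
        (Finset.mul_sum ..).symm
    _ ≤ Real.exp (η * p) * ∑' n : ℤ, Real.exp (-(η * p) * |((n - m : ℤ) : ℝ)|) := by
        gcongr
        exact ((Equiv.subRight m).summable_iff.2 hsum).sum_le_tsum s
          fun n _ => (Real.exp_pos _).le
    _ = _ := by
        rw [← (Equiv.subRight m).tsum_eq fun n : ℤ => Real.exp (-(η * p) * |(n : ℝ)|)]
        rfl

theorem integral_mul_le_sqrt_mul_sqrt {α : Type*} [MeasurableSpace α] {μ : Measure α}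
    {f g : α → ℝ} (hf : 0 ≤ f) (hg : 0 ≤ g) (hf₂ : MemLp f 2 μ) (hg₂ : MemLp g 2 μ) :
    ∫ x, f x * g x ∂μ ≤ √(∫ x, f x ^ 2 ∂μ) * √(∫ x, g x ^ 2 ∂μ) := by
  have h := integral_mul_le_Lp_mul_Lq_of_nonneg (μ := μ) Real.HolderConjugate.two_two
    (.of_forall hf) (.of_forall hg) (by simpa using hf₂) (by simpa using hg₂)
  simpa [Real.sqrt_eq_rpow] using h

/-- Hölder's inequality for three translates of one function, with exponents `4, 4, 2`. -/
theorem integral_abs_mul_translates_le {w : ℝ → ℝ} (hw : Measurable w)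
    (h₂ : Integrable fun x => w x ^ 2) (h₄ : Integrable fun x => w x ^ 4) (a b c : ℝ) :
    ∫ x, |w (x - a) * w (x - b) * w (x - c)| ≤ √(∫ x, w x ^ 4) * √(∫ x, w x ^ 2) := by
  have ha := h₄.comp_sub_right a
  have hb := h₄.comp_sub_right b
  have hc := h₂.comp_sub_right c
  have hle (x : ℝ) : |w (x - a) * w (x - b)| ^ 2 ≤ (w (x - a) ^ 4 + w (x - b) ^ 4) / 2 := by
    rw [sq_abs]
    nlinarith [sq_nonneg (w (x - a) ^ 2 - w (x - b) ^ 2)]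
  have hab : Integrable fun x => |w (x - a) * w (x - b)| ^ 2 := by
    refine ((ha.add hb).div_const 2).mono' (by fun_prop) (.of_forall fun x => ?_)
    rw [Real.norm_of_nonneg (by positivity)]
    exact hle x
  have hint : ∫ x, |w (x - a) * w (x - b)| ^ 2 ≤ ∫ x, w x ^ 4 := by
    refine (integral_mono hab ((ha.add hb).div_const 2) hle).trans_eq ?_
    simp only [Pi.add_apply]
    rw [integral_div, integral_add ha hb, integral_sub_right_eq_self (fun x => w x ^ 4),
      integral_sub_right_eq_self (fun x => w x ^ 4)]
    ring
  have hcint : ∫ x, |w (x - c)| ^ 2 = ∫ x, w x ^ 2 := by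
    simp only [sq_abs]
    exact integral_sub_right_eq_self (fun x => w x ^ 2) c
  calc ∫ x, |w (x - a) * w (x - b) * w (x - c)|
      = ∫ x, |w (x - a) * w (x - b)| * |w (x - c)| := by simp only [abs_mul]
    _ ≤ √(∫ x, |w (x - a) * w (x - b)| ^ 2) * √(∫ x, |w (x - c)| ^ 2) :=
        integral_mul_le_sqrt_mul_sqrt (fun x => abs_nonneg _) (fun x => abs_nonneg _)
          ((memLp_two_iff_integrable_sq (by fun_prop)).2 hab)
          ((memLp_two_iff_integrable_sq
            (by fun_prop : Measurable fun x => |w (x - c)|).aestronglyMeasurable).2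
            (by simpa only [sq_abs] using hc))
    _ ≤ _ := by rw [hcint]; gcongr

/-- **Uniform summability of overlap coefficients of exponentially localized
translates.** Let `η > 0`, `C > 0`. There exists `A > 0` (depending only on
`C` and `η`) such that for every measurable `w₀ : ℝ → ℝ` with
`|w₀(x)| ≤ C e^{−η|x|}`, setting `wₙ(x) = w₀(x − 2πn)`, for all
`(n₁, n₂, n₃) ∈ ℤ³` the sum `Σ_{n ∈ ℤ} |∫ wₙ wₙ₁ wₙ₂ wₙ₃|` converges and is
bounded by `A ‖w₀‖²_{L⁴} ‖w₀‖_{L²}`. -/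
theorem overlap_coefficients_summable (η C : ℝ) (hη : 0 < η) (hC : 0 < C) :
    ∃ A : ℝ, 0 < A ∧
      ∀ w₀ : ℝ → ℝ, Measurable w₀ →
        (∀ x : ℝ, |w₀ x| ≤ C * Real.exp (-η * |x|)) →
        ∀ n₁ n₂ n₃ : ℤ,
          Summable (fun n : ℤ =>
            |∫ x : ℝ, w₀ (x - 2 * Real.pi * n) * w₀ (x - 2 * Real.pi * n₁) *
              w₀ (x - 2 * Real.pi * n₂) * w₀ (x - 2 * Real.pi * n₃)|) ∧
          (∑' n : ℤ,
            |∫ x : ℝ, w₀ (x - 2 * Real.pi * n) * w₀ (x - 2 * Real.pi * n₁) *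
              w₀ (x - 2 * Real.pi * n₂) * w₀ (x - 2 * Real.pi * n₃)|) ≤
            A * Real.sqrt (∫ x : ℝ, (w₀ x) ^ 4) * Real.sqrt (∫ x : ℝ, (w₀ x) ^ 2) := by
  set S : ℝ := ∑' n : ℤ, Real.exp (-(η * (2 * Real.pi)) * |(n : ℝ)|)
  set K : ℝ := C * (Real.exp (η * (2 * Real.pi)) * S)
  have hS : 0 < S := (summable_int_exp_neg_mul_abs (by positivity)).tsum_pos
    (fun n => (Real.exp_pos _).le) 0 (Real.exp_pos _)
  have hK₀ : 0 < K := by positivity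
  refine ⟨K, hK₀, fun w₀ hw hdec n₁ n₂ n₃ => ?_⟩
  have hbdd (x : ℝ) : ‖w₀ x‖ ≤ C := (hdec x).trans <|
    mul_le_of_le_one_right hC.le (Real.exp_le_one_iff.2 (by nlinarith [abs_nonneg x]))
  have h₁ : Integrable w₀ := ((integrable_exp_neg_mul_abs hη).const_mul C).mono'
    hw.aestronglyMeasurable (.of_forall hdec)
  have hmul {f : ℝ → ℝ} (hf : Integrable f) (a : ℝ) : Integrable fun x => f x * w₀ (x - a) :=
    hf.mul_bdd (by fun_prop : Measurable fun x => w₀ (x - a)).aestronglyMeasurable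
      (.of_forall fun x => hbdd (x - a))
  have h₂ : Integrable fun x => w₀ x ^ 2 := by
    simpa [pow_succ] using hmul h₁ 0
  have h₄ : Integrable fun x => w₀ x ^ 4 := by
    simpa [pow_succ] using hmul (hmul (hmul h₁ 0) 0) 0
  have h₃ : Integrable fun x : ℝ => w₀ (x - 2 * Real.pi * n₁) * w₀ (x - 2 * Real.pi * n₂) *
      w₀ (x - 2 * Real.pi * n₃) := hmul (hmul (h₁.comp_sub_right _) _) _
  have hprod (n : ℤ) : Integrable fun x : ℝ =>
      w₀ (x - 2 * Real.pi * n) * w₀ (x - 2 * Real.pi * n₁) *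
        w₀ (x - 2 * Real.pi * n₂) * w₀ (x - 2 * Real.pi * n₃) :=
    hmul (hmul (hmul (h₁.comp_sub_right _) _) _) _
  have hpartial (s : Finset ℤ) : ∑ n ∈ s,
      |∫ x : ℝ, w₀ (x - 2 * Real.pi * n) * w₀ (x - 2 * Real.pi * n₁) *
        w₀ (x - 2 * Real.pi * n₂) * w₀ (x - 2 * Real.pi * n₃)| ≤
      K * √(∫ x : ℝ, w₀ x ^ 4) * √(∫ x : ℝ, w₀ x ^ 2) := by
    have hK (x : ℝ) : ∑ n ∈ s, |w₀ (x - 2 * Real.pi * n)| ≤ K :=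
      calc _ ≤ ∑ n ∈ s, C * Real.exp (-η * |x - 2 * Real.pi * n|) :=
            Finset.sum_le_sum fun n _ => hdec _
        _ = C * ∑ n ∈ s, Real.exp (-η * |x - 2 * Real.pi * n|) := (Finset.mul_sum ..).symm
        _ ≤ K := mul_le_mul_of_nonneg_left
            (sum_exp_neg_mul_abs_sub_le hη Real.two_pi_pos s x) hC.le
    calc _ ≤ ∑ n ∈ s, ∫ x : ℝ, |w₀ (x - 2 * Real.pi * n) * w₀ (x - 2 * Real.pi * n₁) *
            w₀ (x - 2 * Real.pi * n₂) * w₀ (x - 2 * Real.pi * n₃)| :=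
          Finset.sum_le_sum fun n _ => abs_integral_le_integral_abs
      _ = ∫ x : ℝ, ∑ n ∈ s, |w₀ (x - 2 * Real.pi * n) * w₀ (x - 2 * Real.pi * n₁) *
            w₀ (x - 2 * Real.pi * n₂) * w₀ (x - 2 * Real.pi * n₃)| :=
          (integral_finsetSum s fun n _ => (hprod n).abs).symm
      _ ≤ ∫ x : ℝ, K * |w₀ (x - 2 * Real.pi * n₁) * w₀ (x - 2 * Real.pi * n₂) *
            w₀ (x - 2 * Real.pi * n₃)| := by
          refine integral_mono (integrable_finsetSum s fun n _ => (hprod n).abs)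
            (h₃.abs.const_mul K) fun x => ?_
          refine le_trans (le_of_eq ?_) (mul_le_mul_of_nonneg_right (hK x) (abs_nonneg _))
          rw [Finset.sum_mul]
          exact Finset.sum_congr rfl fun n _ => by simp only [abs_mul, mul_assoc]
      _ = K * ∫ x : ℝ, |w₀ (x - 2 * Real.pi * n₁) * w₀ (x - 2 * Real.pi * n₂) *
            w₀ (x - 2 * Real.pi * n₃)| := integral_const_mul ..
      _ ≤ _ := by
          rw [mul_assoc K]
          exact mul_le_mul_of_nonneg_left
            (integral_abs_mul_translates_le hw h₂ h₄ _ _ _) hK₀.le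
  exact ⟨summable_of_sum_le (fun n => abs_nonneg _) hpartial,
    Real.tsum_le_of_sum_le (fun n => abs_nonneg _) hpartial⟩
end
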